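/- Let f_0, f_1, f_2, f_3, e_0 be complex numbers such that all denominators and square-root arguments below are nonzero, and define R_1 = √(e_0²(f_0f_1 − f_2f_3)(f_0f_2 − f_1f_3) + (f_0f_1f_3 − f_2)(f_0f_2f_3 − f_1)), R_2 = √(e_0²(f_0f_1f_2 − f_3)(f_1f_2f_3 − f_0) + (f_0f_1f_2f_3 − 1)(f_1f_2 − f_0f_3)). Then e_1 = (e_0 f_0 f_2 (f_1² − 1)(f_3² − 1) + R_1 R_2) / (e_0²(f_0f_2 − f_1f_3)(f_0 − f_1f_2f_3) + (f_0f_3 − f_1f_2)(f_0f_2f_3 − f_1)), e_2 = (− R_1 R_2) / (e_0²(f_0f_1 − f_2f_3)(f_0f_2 − f_1f_3) + (f_0f_1f_3 − f_2)(f_0f_2f_3 − f_1)), e_3 = (e_0 f_1 f_3 (f_0² − 1)(f_2² − 1) + R_1 R_2) / (e_0²(f_0f_2 − f_1f_3)(f_0f_1f_2 − f_3) + (f_0f_3 − f_1f_2)(f_0f_1f_3 − f_2)) satisfy the three closure equations q_2 = q_1 = q_0 = 0 (with q_0, q_1, q_2 as in the n = 4 Kokotsakis closure condition). -/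

import Mathlib

/-- A trilinear form evaluated at the given shape of `e_1, e_2, e_3`. -/
theorem trilinear_aux (c0 c1 c2 c3 c12 c23 c13 c123 P Q S A D1 D2 D3 e1 e2 e3 : ℂ)
    (he1 : e1 = (P + S) / D1) (he2 : e2 = -S / D2) (he3 : e3 = (Q + S) / D3)
    (hS : S ^ 2 = D2 * A) (h1 : D1 ≠ 0) (h2 : D2 ≠ 0) (h3 : D3 ≠ 0)
    (X : c0 * D1 * D3 + c1 * P * D3 + c3 * Q * D1 - c12 * A * D3 - c23 * A * D1
      + c13 * (P * Q + D2 * A) - c123 * (P + Q) * A = 0)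
    (Y : c1 * D3 * D2 - c2 * D1 * D3 + c3 * D1 * D2 - c12 * P * D3 - c23 * Q * D1
      + c13 * (P + Q) * D2 - c123 * (P * Q + D2 * A) = 0) :
    c0 + c1 * e1 + c2 * e2 + c3 * e3 + c12 * e1 * e2 + c23 * e2 * e3
      + c13 * e1 * e3 + c123 * e1 * e2 * e3 = 0 := by
  subst he1 he2 he3
  field_simp
  linear_combination D2 * X + S * Y
    + (-c12 * D3 - c23 * D1 + c13 * D2 - c123 * (P + Q) - c123 * S) * hS

/-- The explicit solution of the `n = 4` closure conditions: with `R_1, R_2` square roots of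
the stated expressions, the given `e_1, e_2, e_3` satisfy `q_2 = q_1 = q_0 = 0`. -/
theorem closure_n4_solution_es (f0 f1 f2 f3 e0 R1 R2 e1 e2 e3 : ℂ)
    (hR1 : R1 ^ 2 = e0 ^ 2 * (f0 * f1 - f2 * f3) * (f0 * f2 - f1 * f3)
        + (f0 * f1 * f3 - f2) * (f0 * f2 * f3 - f1))
    (hR2 : R2 ^ 2 = e0 ^ 2 * (f0 * f1 * f2 - f3) * (f1 * f2 * f3 - f0)
        + (f0 * f1 * f2 * f3 - 1) * (f1 * f2 - f0 * f3))
    (hR1n : R1 ≠ 0) (hR2n : R2 ≠ 0)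
    (hD1 : e0 ^ 2 * (f0 * f2 - f1 * f3) * (f0 - f1 * f2 * f3)
        + (f0 * f3 - f1 * f2) * (f0 * f2 * f3 - f1) ≠ 0)
    (hD2 : e0 ^ 2 * (f0 * f1 - f2 * f3) * (f0 * f2 - f1 * f3)
        + (f0 * f1 * f3 - f2) * (f0 * f2 * f3 - f1) ≠ 0)
    (hD3 : e0 ^ 2 * (f0 * f2 - f1 * f3) * (f0 * f1 * f2 - f3)
        + (f0 * f3 - f1 * f2) * (f0 * f1 * f3 - f2) ≠ 0)
    (he1 : e1 = (e0 * f0 * f2 * (f1 ^ 2 - 1) * (f3 ^ 2 - 1) + R1 * R2) /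
        (e0 ^ 2 * (f0 * f2 - f1 * f3) * (f0 - f1 * f2 * f3)
          + (f0 * f3 - f1 * f2) * (f0 * f2 * f3 - f1)))
    (he2 : e2 = (-(R1 * R2)) /
        (e0 ^ 2 * (f0 * f1 - f2 * f3) * (f0 * f2 - f1 * f3)
          + (f0 * f1 * f3 - f2) * (f0 * f2 * f3 - f1)))
    (he3 : e3 = (e0 * f1 * f3 * (f0 ^ 2 - 1) * (f2 ^ 2 - 1) + R1 * R2) /
        (e0 ^ 2 * (f0 * f2 - f1 * f3) * (f0 * f1 * f2 - f3)
          + (f0 * f3 - f1 * f2) * (f0 * f1 * f3 - f2))) :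
    f0 * (e0 * f3 * (e1 * e2 * f2 + e2 * e3 * f1 + e1 * e3 - f1 * f2) +
        e1 * e2 * e3 * f2 - e3 * f1 * f2 - e2 * f1 - e1) = 0 ∧
    e1 * e2 * f0 * f2 * f3 + e2 * e3 * f0 * f1 * f3 + e1 * e3 * f0 * f3
      - e1 * e3 * f1 * f2 - f0 * f1 * f2 * f3 - e1 * e2 * f1 - e2 * e3 * f2 + 1
      + e0 * (e1 * e2 * e3 * f1 * f3 - e1 * e2 * e3 * f0 * f2 - e1 * f1 * f2 * f3
        + e3 * f0 * f1 * f2 + e2 * f0 * f1 - e2 * f2 * f3 + e1 * f0 - e3 * f3) = 0 ∧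
    e0 * (e1 * e3 * f1 * f2 + e1 * e2 * f1 + e2 * e3 * f2 - 1) +
      f3 * (e1 * e2 * e3 * f1 - e1 * f1 * f2 - e2 * f2 - e3) = 0 := by
  have hS := mul_pow R1 R2 2
  rw [hR1, hR2] at hS
  refine ⟨?_, ?_, ?_⟩
  · refine Eq.trans ?_ (trilinear_aux (-(f0 * e0 * f3 * f1 * f2)) (-f0) (-(f0 * f1)) (-(f0 * f1 * f2)) (f0 * e0 * f3 * f2) (f0 * e0 * f3 * f1) (f0 * e0 * f3) (f0 * f2)
      _ _ _ _ _ _ _ _ _ _ he1 he2 he3 hS hD1 hD2 hD3 ?_ ?_)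
    · ring1
    · ring1
    · ring1
  · refine Eq.trans ?_ (trilinear_aux (1-f0 * f1 * f2 * f3) (e0 * (f0-f1 * f2 * f3)) (e0 * (f0 * f1-f2 * f3)) (e0 * (f0 * f1 * f2-f3)) (f0 * f2 * f3-f1) (f0 * f1 * f3-f2) (f0 * f3-f1 * f2) (e0 * (f1 * f3-f0 * f2))
      _ _ _ _ _ _ _ _ _ _ he1 he2 he3 hS hD1 hD2 hD3 ?_ ?_)
    · ring1
    · ring1
    · ring1
  · refine Eq.trans ?_ (trilinear_aux (-e0) (-(f3 * f1 * f2)) (-(f3 * f2)) (-f3) (e0 * f1) (e0 * f2) (e0 * f1 * f2) (f3 * f1)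
      _ _ _ _ _ _ _ _ _ _ he1 he2 he3 hS hD1 hD2 hD3 ?_ ?_)
    · ring1
    · ring1
    · ring1
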